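/- arXiv:2406.09668 — 7 statements merged into one kernel-verified Lean document; each statement's English description precedes it below -/
import Mathlib

section
/- Let p, q : ℝ → ℂ be continuous, z ∈ ℂ, λ = z³, and let η be a solution of Eq.(1b) with coefficients p, q and parameter λ such that η(x) ≠ 0 for all x ∈ ℝ. Define ξ := η'/η − z. Then ξ is differentiable, the function ξ' + p (which equals η^{[2]}/η − (η'/η)²) is differentiable, and on all of ℝ one has (ξ' + p)' + 3z(ξ' + p) + 3z²ξ + 3ξ(ξ' + p) + 3zξ² + ξ³ − p·ξ − z·p + q = 0. -/
/-- `y` is a solution of Eq.(1b): `(y'' + p·y)' + p·y' + q·y = λ·y`. -/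
def IsSol3 (p q : ℝ → ℂ) (lam : ℂ) (y : ℝ → ℂ) : Prop :=
  Differentiable ℝ y ∧ Differentiable ℝ (deriv y) ∧
  Differentiable ℝ (fun t => deriv (deriv y) t + p t * y t) ∧
  ∀ x : ℝ, deriv (fun t => deriv (deriv y) t + p t * y t) x
      + p x * deriv y x + q x * y x = lam * y x

/-- If `η` is a nonvanishing solution of Eq.(1b) with `λ = z³`, then `ξ = η'/η − z`
satisfies the Riccati-type equation
`(ξ' + p)' + 3z(ξ' + p) + 3z²ξ + 3ξ(ξ' + p) + 3zξ² + ξ³ − pξ − zp + q = 0`. -/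
theorem xi_riccati_equation
    (p q : ℝ → ℂ) (hp : Continuous p) (hq : Continuous q)
    (z lam : ℂ) (hlam : lam = z ^ 3)
    (η : ℝ → ℂ) (hη : IsSol3 p q lam η) (hηne : ∀ x : ℝ, η x ≠ 0)
    (ξ : ℝ → ℂ) (hξ : ∀ x : ℝ, ξ x = deriv η x / η x - z) :
    Differentiable ℝ ξ ∧
    (∀ x : ℝ, deriv ξ x + p x =
      (deriv (deriv η) x + p x * η x) / η x - (deriv η x / η x) ^ 2) ∧
    Differentiable ℝ (fun t => deriv ξ t + p t) ∧
    ∀ x : ℝ,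
      deriv (fun t => deriv ξ t + p t) x + 3 * z * (deriv ξ x + p x)
        + 3 * z ^ 2 * ξ x + 3 * ξ x * (deriv ξ x + p x) + 3 * z * ξ x ^ 2
        + ξ x ^ 3 - p x * ξ x - z * p x + q x = 0 := by
  obtain ⟨h0, h1, h2, heq⟩ := hη
  have hu : ∀ x : ℝ, HasDerivAt (fun t => deriv η t / η t)
      ((deriv (deriv η) x * η x - deriv η x * deriv η x) / η x ^ 2) x := fun x =>
    (h1 x).hasDerivAt.div (h0 x).hasDerivAt (hηne x)
  have hξd : ∀ x : ℝ, HasDerivAt ξ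
      ((deriv (deriv η) x * η x - deriv η x * deriv η x) / η x ^ 2) x := fun x => by
    rw [funext hξ]
    exact (hu x).sub_const z
  have hF : ∀ x : ℝ, deriv ξ x + p x =
      (deriv (deriv η) x + p x * η x) / η x - (deriv η x / η x) ^ 2 := fun x => by
    rw [(hξd x).deriv]
    have := hηne x
    field_simp
    ring
  have hFd : ∀ x : ℝ, HasDerivAt (fun t => deriv ξ t + p t)
      ((deriv (fun t => deriv (deriv η) t + p t * η t) x * η x
          - (deriv (deriv η) x + p x * η x) * deriv η x) / η x ^ 2
        - 2 * (deriv η x / η x)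
          * ((deriv (deriv η) x * η x - deriv η x * deriv η x) / η x ^ 2)) x := fun x => by
    rw [funext hF]
    have h := ((h2 x).hasDerivAt.div (h0 x).hasDerivAt (hηne x)).sub ((hu x).pow 2)
    refine HasDerivAt.congr_deriv h ?_
    simp
  refine ⟨fun x => (hξd x).differentiableAt, hF, fun x => (hFd x).differentiableAt, fun x => ?_⟩
  have hW : deriv (fun t => deriv (deriv η) t + p t * η t) x
      = z ^ 3 * η x - p x * deriv η x - q x * η x := by
    rw [← hlam]
    linear_combination heq x
  rw [(hFd x).deriv, hF, hξ, hW]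
  have := hηne x
  field_simp
  ring
end

section
/- Let p, q : ℝ → ℂ be continuous, z ∈ ℂ with z ≠ 0, and let ξ : ℝ → ℂ be a differentiable function such that ξ' + p is differentiable and (ξ' + p)' + 3z(ξ' + p) + 3z²ξ + 3ξ(ξ' + p) + 3zξ² + ξ³ − p·ξ − z·p + q = 0 on ℝ. Define X₁ := −ω²·ξ + (i/(√3·z))·(ξ' + p), X₂ := −ω·ξ − (i/(√3·z))·(ξ' + p), and K := (i·p/(√3·z))·(X₁ + X₂) + 3(X₁ + X₂)(ω·X₁ − ω²·X₂) − i√3·(X₁ + X₂)² − (i/(√3·z))·(X₁ + X₂)³. Then on all of ℝ one has X₁' = i√3·z·ω·X₁ + (i/√3)·(ω·p − q/z) + K and X₂' = −i√3·z·ω²·X₂ + (i/√3)·(−ω²·p + q/z) − K. -/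
open Complex

/-- The primitive cube root of unity `exp (2πi/3)` in algebraic form. -/
theorem one_add_two_mul_exp_two_pi_I_div_three :
    1 + 2 * Complex.exp (2 * Real.pi * Complex.I / 3) = Complex.I * (Real.sqrt 3 : ℂ) := by
  have harg : (2 * Real.pi * Complex.I / 3 : ℂ) = ((Real.pi - Real.pi / 3 : ℝ) : ℂ) * I := by
    push_cast
    ring
  rw [harg, Complex.exp_mul_I, ← Complex.ofReal_cos, ← Complex.ofReal_sin, Real.cos_pi_sub,
    Real.sin_pi_sub, Real.cos_pi_div_three, Real.sin_pi_div_three]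
  push_cast
  ring

/-- The diagonalized first-order system for `X = (X₁, X₂)` obtained from the Riccati-type
equation for `ξ`: `X₁' = i√3·z·ω·X₁ + (i/√3)(ω·p − q/z) + K` and
`X₂' = −i√3·z·ω²·X₂ + (i/√3)(−ω²·p + q/z) − K`, where `ω = exp(2πi/3)`. -/
theorem diagonalized_system
    (p q : ℝ → ℂ) (hp : Continuous p) (hq : Continuous q)
    (z : ℂ) (hz : z ≠ 0)
    (ξ : ℝ → ℂ) (hξ : Differentiable ℝ ξ)
    (hξp : Differentiable ℝ (fun t => deriv ξ t + p t))
    (heq : ∀ x : ℝ,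
      deriv (fun t => deriv ξ t + p t) x + 3 * z * (deriv ξ x + p x)
        + 3 * z ^ 2 * ξ x + 3 * ξ x * (deriv ξ x + p x) + 3 * z * ξ x ^ 2
        + ξ x ^ 3 - p x * ξ x - z * p x + q x = 0)
    (ω : ℂ) (hω : ω = Complex.exp (2 * Real.pi * Complex.I / 3))
    (X₁ X₂ K : ℝ → ℂ)
    (hX₁ : ∀ x : ℝ, X₁ x = -ω ^ 2 * ξ x
        + Complex.I / ((Real.sqrt 3 : ℂ) * z) * (deriv ξ x + p x))
    (hX₂ : ∀ x : ℝ, X₂ x = -ω * ξ x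
        - Complex.I / ((Real.sqrt 3 : ℂ) * z) * (deriv ξ x + p x))
    (hK : ∀ x : ℝ, K x = Complex.I * p x / ((Real.sqrt 3 : ℂ) * z) * (X₁ x + X₂ x)
        + 3 * (X₁ x + X₂ x) * (ω * X₁ x - ω ^ 2 * X₂ x)
        - Complex.I * (Real.sqrt 3 : ℂ) * (X₁ x + X₂ x) ^ 2
        - Complex.I / ((Real.sqrt 3 : ℂ) * z) * (X₁ x + X₂ x) ^ 3) :
    (∀ x : ℝ, deriv X₁ x = Complex.I * (Real.sqrt 3 : ℂ) * z * ω * X₁ x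
        + Complex.I / (Real.sqrt 3 : ℂ) * (ω * p x - q x / z) + K x) ∧
    (∀ x : ℝ, deriv X₂ x = -(Complex.I * (Real.sqrt 3 : ℂ) * z * ω ^ 2) * X₂ x
        + Complex.I / (Real.sqrt 3 : ℂ) * (-ω ^ 2 * p x + q x / z) - K x) := by
  have hs : (Real.sqrt 3 : ℂ) ^ 2 = 3 := by
    rw [← Complex.ofReal_pow, Real.sq_sqrt (by norm_num)]
    norm_num
  have hs0 : (Real.sqrt 3 : ℂ) ≠ 0 := by
    intro h
    norm_num [h] at hs
  have hIs : Complex.I * (Real.sqrt 3 : ℂ) = 1 + 2 * ω := by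
    rw [hω, one_add_two_mul_exp_two_pi_I_div_three]
  have hω2 : ω ^ 2 = -1 - ω := by
    have hsq : (1 + 2 * ω) ^ 2 = -3 := by
      rw [← hIs, mul_pow, hs, Complex.I_sq]
      ring
    linear_combination hsq / 4
  have hdiv : Complex.I / (Real.sqrt 3 : ℂ) = (1 + 2 * ω) / 3 := by
    rw [← hIs, div_eq_div_iff hs0 (by norm_num), ← hs]
    ring
  have hc : Complex.I / ((Real.sqrt 3 : ℂ) * z) = (1 + 2 * ω) / 3 / z := by
    rw [← div_div, hdiv]
  have hcp (x : ℝ) : Complex.I * p x / ((Real.sqrt 3 : ℂ) * z)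
      = (1 + 2 * ω) / 3 / z * p x := by
    rw [← hc]
    ring
  have hd₁ (x : ℝ) : deriv X₁ x = -ω ^ 2 * deriv ξ x
      + (1 + 2 * ω) / 3 / z * deriv (fun t => deriv ξ t + p t) x := by
    rw [funext hX₁, hc]
    exact (((hξ x).hasDerivAt.const_mul _).add ((hξp x).hasDerivAt.const_mul _)).deriv
  have hd₂ (x : ℝ) : deriv X₂ x = -ω * deriv ξ x
      - (1 + 2 * ω) / 3 / z * deriv (fun t => deriv ξ t + p t) x := by
    rw [funext hX₂, hc]
    exact (((hξ x).hasDerivAt.const_mul _).sub ((hξp x).hasDerivAt.const_mul _)).deriv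
  have hsum (x : ℝ) : X₁ x + X₂ x = ξ x := by
    rw [hX₁, hX₂]
    linear_combination -ξ x * hω2
  have hlin (x : ℝ) : ω * X₁ x - ω ^ 2 * X₂ x
      = -((1 + 2 * ω) / 3 / z) * (deriv ξ x + p x) := by
    rw [hX₁, hX₂, hc]
    linear_combination (1 + 2 * ω) / 3 / z * (deriv ξ x + p x) * hω2
  have hv (x : ℝ) : deriv (fun t => deriv ξ t + p t) x = -(3 * z * (deriv ξ x + p x)
      + 3 * z ^ 2 * ξ x + 3 * ξ x * (deriv ξ x + p x) + 3 * z * ξ x ^ 2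
      + ξ x ^ 3 - p x * ξ x - z * p x + q x) := by
    linear_combination heq x
  have hω3 : ω ^ 3 = 1 := by
    linear_combination (ω - 1) * hω2
  have hω4 : ω ^ 4 = ω := by
    linear_combination ω * hω3
  constructor
  · intro x
    rw [hd₁, hK, hsum, hlin, hcp, hv, hX₁, hIs, hdiv, hc]
    field_simp
    ring_nf
    simp only [hω2, hω3, hω4]
    ring
  · intro x
    rw [hd₂, hK, hsum, hlin, hcp, hv, hX₂, hIs, hdiv, hc]
    field_simp
    ring_nf
    simp only [hω2, hω3, hω4]
    ring
end

section
/- Let p, q : ℝ → ℂ be continuous and λ ∈ ℂ. If f and g are solutions of Eq.(1b) with coefficients p, q and parameter λ, then the function ỹ := f·g' − f'·g is a solution of the transpose equation −(ỹ'' + p·ỹ)' − p·ỹ' + q·ỹ = λ·ỹ; that is, ỹ is twice differentiable, ỹ^{[2]} := ỹ'' + p·ỹ is differentiable, and the transpose equation holds at every point of ℝ. -/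
/-- `y` is a solution of the transpose equation `−(y'' + p·y)' − p·y' + q·y = λ·y`. -/
def IsTSol3 (p q : ℝ → ℂ) (lam : ℂ) (y : ℝ → ℂ) : Prop :=
  Differentiable ℝ y ∧ Differentiable ℝ (deriv y) ∧
  Differentiable ℝ (fun t => deriv (deriv y) t + p t * y t) ∧
  ∀ x : ℝ, -deriv (fun t => deriv (deriv y) t + p t * y t) x
      - p x * deriv y x + q x * y x = lam * y x

/-- If `f` and `g` are solutions of Eq.(1b), then `ỹ = f·g' − f'·g` solves the transpose
equation `−(ỹ'' + p·ỹ)' − p·ỹ' + q·ỹ = λ·ỹ`. -/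
theorem wronskian_solves_transpose
    (p q : ℝ → ℂ) (hp : Continuous p) (hq : Continuous q) (lam : ℂ)
    (f g : ℝ → ℂ) (hf : IsSol3 p q lam f) (hg : IsSol3 p q lam g) :
    IsTSol3 p q lam (fun x => f x * deriv g x - deriv f x * g x) := by
  obtain ⟨hf0, hf1, hf2, hfe⟩ := hf
  obtain ⟨hg0, hg1, hg2, hge⟩ := hg
  set F : ℝ → ℂ := fun t => deriv (deriv f) t + p t * f t with hF
  set G : ℝ → ℂ := fun t => deriv (deriv g) t + p t * g t with hG
  have hFx (x : ℝ) : F x = deriv (deriv f) x + p x * f x := rfl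
  have hGx (x : ℝ) : G x = deriv (deriv g) x + p x * g x := rfl
  have hy (x : ℝ) : HasDerivAt (fun x => f x * deriv g x - deriv f x * g x)
      (f x * G x - F x * g x) x := by
    refine (((hf0 x).hasDerivAt.mul (hg1 x).hasDerivAt).sub
      ((hf1 x).hasDerivAt.mul (hg0 x).hasDerivAt)).congr_deriv ?_
    rw [hFx, hGx]
    ring
  have hdy : deriv (fun x => f x * deriv g x - deriv f x * g x) =
      fun x => f x * G x - F x * g x := funext fun x => (hy x).deriv
  have hy' (x : ℝ) : HasDerivAt (fun x => f x * G x - F x * g x)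
      (deriv f x * G x + f x * deriv G x - (deriv F x * g x + F x * deriv g x)) x :=
    ((hf0 x).hasDerivAt.mul (hg2 x).hasDerivAt).sub
      ((hf2 x).hasDerivAt.mul (hg0 x).hasDerivAt)
  have hquasi : (fun t => deriv (fun x => f x * G x - F x * g x) t +
      p t * (f t * deriv g t - deriv f t * g t)) =
      fun x => deriv f x * G x - F x * deriv g x := by
    funext x
    rw [(hy' x).deriv]
    linear_combination f x * hge x - g x * hfe x
  have hy'' (x : ℝ) : HasDerivAt (fun x => deriv f x * G x - F x * deriv g x)
      (deriv (deriv f) x * G x + deriv f x * deriv G x -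
        (deriv F x * deriv g x + F x * deriv (deriv g) x)) x :=
    ((hf1 x).hasDerivAt.mul (hg2 x).hasDerivAt).sub
      ((hf2 x).hasDerivAt.mul (hg1 x).hasDerivAt)
  refine ⟨fun x => (hy x).differentiableAt, ?_, ?_, fun x => ?_⟩
  · rw [hdy]
    exact fun x => (hy' x).differentiableAt
  · rw [hdy, hquasi]
    exact fun x => (hy'' x).differentiableAt
  · rw [hdy, hquasi, (hy'' x).deriv]
    linear_combination deriv g x * hfe x - deriv f x * hge x + G x * hFx x - F x * hGx x
end

section
/- Let p, q : ℝ → ℂ be continuous and λ ∈ ℂ. Let ỹ be a solution of the transpose equation −(ỹ'' + p·ỹ)' − p·ỹ' + q·ỹ = λ·ỹ and let g be a solution of Eq.(1b) (y'' + p·y)' + p·y' + q·y = λ·y with g(x) ≠ 0 for all x ∈ ℝ. Define f(x) := g(x)·∫₀ˣ ỹ(s)/g(s)² ds. Then f is twice differentiable, f^{[2]} := f'' + p·f is differentiable, and for all x ∈ ℝ one has (f^{[2]})'(x) + p(x)·f'(x) + q(x)·f(x) − λ·f(x) = C/g(x)², where C denotes the (constant) value of g·ỹ^{[2]} − g'·ỹ'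 + g^{[2]}·ỹ. -/
/-- The Lagrange bracket `g·ỹ^{[2]} − g'·ỹ' + g^{[2]}·ỹ` of a solution `g` of Eq.(1b) and a
solution `ỹ` of the transpose equation is constant. -/
theorem bracket_eq_of_isTSol3_of_isSol3 {p q : ℝ → ℂ} {lam : ℂ} {ty g : ℝ → ℂ}
    (hty : IsTSol3 p q lam ty) (hg : IsSol3 p q lam g) (x y : ℝ) :
    g x * (deriv (deriv ty) x + p x * ty x) - deriv g x * deriv ty x
        + (deriv (deriv g) x + p x * g x) * ty x
      = g y * (deriv (deriv ty) y + p y * ty y) - deriv g y * deriv ty y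
        + (deriv (deriv g) y + p y * g y) * ty y := by
  obtain ⟨ht0, ht1, ht2, ht⟩ := hty
  obtain ⟨hg0, hg1, hg2, hge⟩ := hg
  have key : ∀ t, HasDerivAt (fun t => g t * (deriv (deriv ty) t + p t * ty t)
      - deriv g t * deriv ty t + (deriv (deriv g) t + p t * g t) * ty t) 0 t := fun t => by
    refine ((((hg0 t).hasDerivAt.mul (ht2 t).hasDerivAt).sub
      ((hg1 t).hasDerivAt.mul (ht1 t).hasDerivAt)).add
      ((hg2 t).hasDerivAt.mul (ht0 t).hasDerivAt)).congr_deriv ?_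
    linear_combination ty t * hge t - g t * ht t
  exact is_const_of_deriv_eq_zero (fun t => (key t).differentiableAt) (fun t => (key t).deriv) x y

/-- If `ỹ` solves the transpose equation, `g` is a nonvanishing solution of Eq.(1b) and
`f(x) = g(x)·∫₀ˣ ỹ/g² `, then `(f^{[2]})' + p·f' + q·f − λ·f = C/g²`, where `C` is the
(constant) value of `g·ỹ^{[2]} − g'·ỹ' + g^{[2]}·ỹ`. -/
theorem inhomogeneous_equation_for_f
    (p q : ℝ → ℂ) (hp : Continuous p) (hq : Continuous q) (lam : ℂ)
    (ty g : ℝ → ℂ) (hty : IsTSol3 p q lam ty) (hg : IsSol3 p q lam g)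
    (hgne : ∀ x : ℝ, g x ≠ 0)
    (f : ℝ → ℂ) (hf : ∀ x : ℝ, f x = g x * ∫ s in (0:ℝ)..x, ty s / g s ^ 2) :
    Differentiable ℝ f ∧ Differentiable ℝ (deriv f) ∧
    Differentiable ℝ (fun t => deriv (deriv f) t + p t * f t) ∧
    ∀ x : ℝ,
      deriv (fun t => deriv (deriv f) t + p t * f t) x
          + p x * deriv f x + q x * f x - lam * f x
        = (g 0 * (deriv (deriv ty) 0 + p 0 * ty 0) - deriv g 0 * deriv ty 0
            + (deriv (deriv g) 0 + p 0 * g 0) * ty 0) / g x ^ 2 := by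
  obtain ⟨ht0, ht1, -, -⟩ := id hty
  obtain ⟨hg0, hg1, hg2, hge⟩ := id hg
  have hcont : Continuous fun s => ty s / g s ^ 2 :=
    ht0.continuous.div (hg0.continuous.pow 2) fun x => pow_ne_zero 2 (hgne x)
  set w : ℝ → ℂ := fun x => ∫ s in (0:ℝ)..x, ty s / g s ^ 2
  have hw : ∀ x, HasDerivAt w (ty x / g x ^ 2) x := fun x => hcont.integral_hasStrictDerivAt 0 x
    |>.hasDerivAt
  obtain rfl : f = fun x => g x * w x := funext hf
  have hf1 : ∀ x, HasDerivAt (fun x => g x * w x) (deriv g x * w x + ty x / g x) x := fun x => by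
    refine ((hg0 x).hasDerivAt.mul (hw x)).congr_deriv ?_
    have := hgne x
    field_simp
  have hdf : deriv (fun x => g x * w x) = fun x => deriv g x * w x + ty x / g x :=
    funext fun x => (hf1 x).deriv
  have hf2 : ∀ x, HasDerivAt (fun x => deriv g x * w x + ty x / g x)
      (deriv (deriv g) x * w x + deriv ty x / g x) x := fun x => by
    refine (((hg1 x).hasDerivAt.mul (hw x)).add
      ((ht0 x).hasDerivAt.div (hg0 x).hasDerivAt (hgne x))).congr_deriv ?_
    have := hgne x
    field_simp
    ring
  have hquasi : (fun t => deriv (deriv fun x => g x * w x) t + p t * (g t * w t))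
      = fun t => (deriv (deriv g) t + p t * g t) * w t + deriv ty t / g t := by
    funext t
    rw [hdf, (hf2 t).deriv]
    ring
  have hf3 : ∀ x, HasDerivAt
      (fun t => (deriv (deriv g) t + p t * g t) * w t + deriv ty t / g t) _ x := fun x =>
    ((hg2 x).hasDerivAt.mul (hw x)).add ((ht1 x).hasDerivAt.div (hg0 x).hasDerivAt (hgne x))
  refine ⟨fun x => (hf1 x).differentiableAt, ?_, ?_, fun x => ?_⟩
  · rw [hdf]
    exact fun x => (hf2 x).differentiableAt
  · rw [hquasi]
    exact fun x => (hf3 x).differentiableAt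
  · rw [hquasi, (hf3 x).deriv, hdf, ← bracket_eq_of_isTSol3_of_isSol3 hty hg x 0]
    have hx := hgne x
    have hD : deriv (fun t => deriv (deriv g) t + p t * g t) x
        = lam * g x - q x * g x - p x * deriv g x := by linear_combination hge x
    rw [hD]
    field_simp
    ring
end

section
/- Let φ₁, φ₂, φ₃ : ℝ → ℂ be functions with φ₁(0) = 1, φ₂(0) = 0, φ₃(0) = 0, and define y(x) := φ₂(x)·φ₃(2) − φ₃(x)·φ₂(2). Assume: (a) φ₂(1)·φ₃(2) − φ₃(1)·φ₂(2) = 0 (so that y(1) = 0, as well as y(0) = y(2) = 0); (b) φ₃(2) ≠ 0 and (φ₂(1), φ₃(1)) ≠ (0, 0); (c) there exist constants A₁, A₂, A₃ ∈ ℂ with y(x+1) = A₁·φ₁(x) + A₂·φ₂(x) + A₃·φ₃(x) for all x ∈ ℝ. Then y(x+1) = (A₂/φ₃(2))·y(x) for all x ∈ ℝ; that is, y is a Floquet solution with multiplier A = A₂/φ₃(2). -/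
/-- The eigenfunction `y(x) = φ₂(x)·φ₃(2) − φ₃(x)·φ₂(2)` of the three-point Dirichlet
problem is a Floquet solution: `y(x+1) = (A₂/φ₃(2))·y(x)` for all `x`. -/
theorem three_point_eigenfunction_is_floquet
    (φ₁ φ₂ φ₃ : ℝ → ℂ)
    (h10 : φ₁ 0 = 1) (h20 : φ₂ 0 = 0) (h30 : φ₃ 0 = 0)
    (y : ℝ → ℂ) (hy : ∀ x : ℝ, y x = φ₂ x * φ₃ 2 - φ₃ x * φ₂ 2)
    (ha : φ₂ 1 * φ₃ 2 - φ₃ 1 * φ₂ 2 = 0)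
    (hb1 : φ₃ 2 ≠ 0) (hb2 : ¬(φ₂ 1 = 0 ∧ φ₃ 1 = 0))
    (A₁ A₂ A₃ : ℂ)
    (hc : ∀ x : ℝ, y (x + 1) = A₁ * φ₁ x + A₂ * φ₂ x + A₃ * φ₃ x) :
    ∀ x : ℝ, y (x + 1) = (A₂ / φ₃ 2) * y x := by
  have hA₁ : A₁ = 0 := by
    have h := hc 0
    rw [zero_add, hy, ha, h10, h20, h30] at h
    simpa using h.symm
  have hA : A₂ * φ₂ 1 + A₃ * φ₃ 1 = 0 := by
    have h := hc 1
    rw [one_add_one_eq_two, hy, hA₁] at h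
    linear_combination -h
  have h31 : φ₃ 1 ≠ 0 := by
    intro h
    rw [h, zero_mul, sub_zero] at ha
    exact hb2 ⟨(mul_eq_zero.mp ha).resolve_right hb1, h⟩
  have hA₃ : A₃ * φ₃ 2 + A₂ * φ₂ 2 = 0 :=
    mul_left_cancel₀ h31 (by linear_combination φ₃ 2 * hA - A₂ * ha)
  intro x
  rw [hc, hy, hA₁]
  field_simp
  linear_combination φ₃ x * hA₃
end

section
/- Let p, q : ℝ → ℂ be continuous and 1-periodic (p(x+1) = p(x), q(x+1) = q(x)) and let λ ∈ ℂ. Let ỹ be a solution of the transpose equation −(ỹ'' + p·ỹ)' − p·ỹ' + q·ỹ = λ·ỹ with ỹ(0) = 0 and such that ỹ(x+1) = A·ỹ(x) for all x ∈ ℝ, for some A ∈ ℂ. Let g be a solution of Eq.(1b) (y'' + p·y)' + p·y' + q·y = λ·y with g(x) ≠ 0 for all x and g(x+1) = τ·g(x) for all x, for some τ ∈ ℂ. If τ·A ≠ 1, then there exists a solution f of Eq.(1b) with coefficients p, q and parameter λ such that ỹ = f'·g − f·g' on ℝ. -/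
/-- The Lagrange bracket `z·y^{[2]} − z'·y' + z^{[2]}·y`, where `y^{[2]} = y'' + p·y`. -/
noncomputable def lagrangeBracket (p y z : ℝ → ℂ) (x : ℝ) : ℂ :=
  z x * (deriv (deriv y) x + p x * y x) - deriv z x * deriv y x
    + (deriv (deriv z) x + p x * z x) * y x

/-- Lagrange's identity: the bracket of a solution of Eq.(1b) and a solution of the transpose
equation is constant. -/
theorem lagrangeBracket_const {p q : ℝ → ℂ} {lam : ℂ} {y z : ℝ → ℂ}
    (hy : IsSol3 p q lam y) (hz : IsTSol3 p q lam z) (a b : ℝ) :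
    lagrangeBracket p y z a = lagrangeBracket p y z b := by
  obtain ⟨hy0, hy1, hy2, hyeq⟩ := hy
  obtain ⟨hz0, hz1, hz2, hzeq⟩ := hz
  have key : ∀ x, HasDerivAt (lagrangeBracket p y z) 0 x := by
    intro x
    have h := (((hz0 x).hasDerivAt.mul (hy2 x).hasDerivAt).sub
      ((hz1 x).hasDerivAt.mul (hy1 x).hasDerivAt)).add
      ((hz2 x).hasDerivAt.mul (hy0 x).hasDerivAt)
    refine h.congr_deriv ?_
    linear_combination z x * hyeq x - y x * hzeq x
  exact is_const_of_deriv_eq_zero (fun x => (key x).differentiableAt)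
    (fun x => (key x).deriv) a b

/-- The derivative of a function with multiplier `c` has multiplier `c`. -/
theorem deriv_add_one_of_multiplier {y : ℝ → ℂ} {c : ℂ} (h : ∀ x, y (x + 1) = c * y x) (x : ℝ) :
    deriv y (x + 1) = c * deriv y x := by
  rw [← deriv_comp_add_const, funext h, deriv_const_mul_field]

/-- The Lagrange bracket of functions with multipliers `c` and `d` has multiplier `c * d`. -/
theorem lagrangeBracket_add_one {p y z : ℝ → ℂ} {c d : ℂ} (hp : ∀ x, p (x + 1) = p x)
    (hy : ∀ x, y (x + 1) = c * y x) (hz : ∀ x, z (x + 1) = d * z x) (x : ℝ) :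
    lagrangeBracket p y z (x + 1) = c * d * lagrangeBracket p y z x := by
  have hy' := deriv_add_one_of_multiplier hy
  have hz' := deriv_add_one_of_multiplier hz
  simp only [lagrangeBracket, hp, hy, hz, hy', hz', deriv_add_one_of_multiplier hy',
    deriv_add_one_of_multiplier hz']
  ring

/-- If the Lagrange bracket of `g` and `z` vanishes and `u' = z / g²`, then `u·g` solves Eq.(1b)
and its Wronskian with `g` is `z`. -/
theorem isSol3_mul_and_wronskian {p q : ℝ → ℂ} {lam : ℂ} {g z u : ℝ → ℂ}
    (hg : IsSol3 p q lam g) (hz : IsTSol3 p q lam z) (hgne : ∀ x, g x ≠ 0)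
    (hc : lagrangeBracket p g z = 0) (hu : ∀ x, HasDerivAt u (z x / g x ^ 2) x) :
    IsSol3 p q lam (fun x => u x * g x) ∧
      ∀ x, z x = deriv (fun x => u x * g x) x * g x - u x * g x * deriv g x := by
  obtain ⟨hg0, hg1, hg2, hgeq⟩ := hg
  obtain ⟨hz0, hz1, -, -⟩ := hz
  have h1 : ∀ x, HasDerivAt (fun x => u x * g x) (z x / g x + u x * deriv g x) x := fun x => by
    refine ((hu x).mul (hg0 x).hasDerivAt).congr_deriv ?_
    have := hgne x
    field_simp
  have d1 : deriv (fun x => u x * g x) = fun x => z x / g x + u x * deriv g x :=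
    funext fun x => (h1 x).deriv
  have h2 : ∀ x, HasDerivAt (fun x => z x / g x + u x * deriv g x)
      (deriv z x / g x + u x * deriv (deriv g) x) x := fun x => by
    refine (((hz0 x).hasDerivAt.div (hg0 x).hasDerivAt (hgne x)).add
      ((hu x).mul (hg1 x).hasDerivAt)).congr_deriv ?_
    have := hgne x
    field_simp
    ring
  have d2 : deriv (fun x => z x / g x + u x * deriv g x) =
      fun x => deriv z x / g x + u x * deriv (deriv g) x :=
    funext fun x => (h2 x).deriv
  have hquasi : (fun t => deriv z t / g t + u t * deriv (deriv g) t + p t * (u t * g t)) =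
      fun t => deriv z t / g t + u t * (deriv (deriv g) t + p t * g t) := by
    funext t
    ring
  have h3 : ∀ x, HasDerivAt
      (fun t => deriv z t / g t + u t * (deriv (deriv g) t + p t * g t))
      (-(p x * (z x / g x)) +
        u x * deriv (fun t => deriv (deriv g) t + p t * g t) x) x := fun x => by
    refine (((hz1 x).hasDerivAt.div (hg0 x).hasDerivAt (hgne x)).add
      ((hu x).mul (hg2 x).hasDerivAt)).congr_deriv ?_
    have hcx : lagrangeBracket p g z x = 0 := congrFun hc x
    rw [lagrangeBracket] at hcx
    have := hgne x
    field_simp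
    linear_combination hcx
  refine ⟨⟨fun x => (h1 x).differentiableAt, ?_, ?_, ?_⟩, fun x => ?_⟩
  · rw [d1]
    exact fun x => (h2 x).differentiableAt
  · rw [d1, d2, hquasi]
    exact fun x => (h3 x).differentiableAt
  · intro x
    rw [d1, d2, hquasi, (h3 x).deriv]
    linear_combination u x * hgeq x
  · have := hgne x
    rw [d1]
    field_simp
    ring

/-- If `ỹ` is a Floquet solution, vanishing at `0`, of the transpose equation with
multiplier `A`, `g` is a nonvanishing Floquet solution of Eq.(1b) with multiplier `τ`,
and `τ·A ≠ 1`, then `ỹ = f'·g − f·g'` for some solution `f` of Eq.(1b). -/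
theorem transpose_floquet_is_wronskian
    (p q : ℝ → ℂ) (hp : Continuous p) (hq : Continuous q)
    (hpper : ∀ x : ℝ, p (x + 1) = p x) (hqper : ∀ x : ℝ, q (x + 1) = q x)
    (lam : ℂ)
    (ty : ℝ → ℂ) (hty : IsTSol3 p q lam ty) (hty0 : ty 0 = 0)
    (A : ℂ) (htyA : ∀ x : ℝ, ty (x + 1) = A * ty x)
    (g : ℝ → ℂ) (hg : IsSol3 p q lam g) (hgne : ∀ x : ℝ, g x ≠ 0)
    (τ : ℂ) (hgτ : ∀ x : ℝ, g (x + 1) = τ * g x)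
    (hτA : τ * A ≠ 1) :
    ∃ f : ℝ → ℂ, IsSol3 p q lam f ∧
      ∀ x : ℝ, ty x = deriv f x * g x - f x * deriv g x := by
  have hc : lagrangeBracket p g ty = 0 := by
    have hshift := lagrangeBracket_add_one hpper hgτ htyA 0
    rw [zero_add, lagrangeBracket_const hg hty 1 0] at hshift
    have h0 : lagrangeBracket p g ty 0 = 0 := by
      have : (1 - τ * A) * lagrangeBracket p g ty 0 = 0 := by linear_combination hshift
      exact (mul_eq_zero.mp this).resolve_left (sub_ne_zero.mpr hτA.symm)
    funext x
    rw [lagrangeBracket_const hg hty x 0, h0, Pi.zero_apply]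
  have hcont : Continuous fun t => ty t / g t ^ 2 :=
    hty.1.continuous.div (hg.1.continuous.pow 2) fun x => pow_ne_zero 2 (hgne x)
  have hu : ∀ x : ℝ, HasDerivAt (fun x => ∫ t in (0 : ℝ)..x, ty t / g t ^ 2)
      (ty x / g x ^ 2) x := fun x => hcont.integral_hasStrictDerivAt 0 x |>.hasDerivAt
  exact ⟨_, isSol3_mul_and_wronskian hg hty hgne hc hu⟩
end

section
/- Let φ, η, σ : ℝ → ℂ be differentiable functions with η(x) ≠ 0 and σ(x)² = η(x) for all x ∈ ℝ. Suppose there are constants τ₁, τ₃, μ ∈ ℂ with φ(x+1) = τ₁·φ(x), η(x+1) = τ₃·η(x) and σ(x+1) = μ·σ(x) for all x (necessarily μ² = τ₃). Then the function f := (φ'·η − φ·η')/σ satisfies f(x+1) = μ·τ₁·f(x) for all x ∈ ℝ. In other words, McKean's transformation sends a Floquet solution with multiplier τ₁ to a Floquet solution with multiplier τ₃^{1/2}·τ₁. -/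
/-- The derivative of a Floquet solution is a Floquet solution with the same multiplier. -/
lemma deriv_add_one_of_floquet {u : ℝ → ℂ} {τ : ℂ} (hu : ∀ x : ℝ, u (x + 1) = τ * u x) (x : ℝ) :
    deriv u (x + 1) = τ * deriv u x := by
  rw [← deriv_comp_add_const, funext hu, deriv_const_mul_field]


/-- McKean's transformation sends a Floquet solution `φ` with multiplier `τ₁` to a
Floquet solution `f = (φ'·η − φ·η')/σ` with multiplier `μ·τ₁`, where `σ = √η` has
multiplier `μ` (so `μ² = τ₃`). -/
theorem mckean_preserves_floquet
    (φ η σ : ℝ → ℂ)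
    (hφ : Differentiable ℝ φ) (hη : Differentiable ℝ η) (hσ : Differentiable ℝ σ)
    (hηne : ∀ x : ℝ, η x ≠ 0) (hσ2 : ∀ x : ℝ, σ x ^ 2 = η x)
    (τ₁ τ₃ μ : ℂ)
    (hφF : ∀ x : ℝ, φ (x + 1) = τ₁ * φ x)
    (hηF : ∀ x : ℝ, η (x + 1) = τ₃ * η x)
    (hσF : ∀ x : ℝ, σ (x + 1) = μ * σ x)
    (f : ℝ → ℂ)
    (hf : ∀ x : ℝ, f x = (deriv φ x * η x - φ x * deriv η x) / σ x) :
    ∀ x : ℝ, f (x + 1) = μ * τ₁ * f x := by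
  intro x
  have hσne (y : ℝ) : σ y ≠ 0 := fun h => hηne y (by simp [← hσ2 y, h])
  have hμ : μ ≠ 0 := left_ne_zero_of_mul (hσF x ▸ hσne (x + 1))
  have hτ₃ : τ₃ = μ ^ 2 := by
    apply mul_right_cancel₀ (hηne x)
    rw [← hηF, ← hσ2, ← hσ2, hσF, mul_pow]
  have hσx := hσne x
  rw [hf, hf, deriv_add_one_of_floquet hφF, deriv_add_one_of_floquet hηF, hφF, hηF, hσF, hτ₃]
  field_simp
end
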